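/- Let A, B be bounded positive operators on a complex Hilbert space with A invertible. If ⟨A^{1/2} ξ, ξ⟩ ≤ ⟨B ξ, ξ⟩^{1/2} and ⟨B^{1/2} ξ, ξ⟩ ≤ ⟨A ξ, ξ⟩^{1/2} hold for all unit vectors ξ ∈ H, then A = B. -/

import Mathlib

open scoped InnerProductSpace

variable {H : Type*} [NormedAddCommGroup H] [InnerProductSpace ℂ H] [CompleteSpace H]

theorem IsSelfAdjoint.inner_apply_left {a : H →L[ℂ] H} (ha : IsSelfAdjoint a) (ξ η : H) :
    ⟪a ξ, η⟫_ℂ = ⟪ξ, a η⟫_ℂ :=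
  ha.isSymmetric ξ η

theorem cfc_mul_apply {f g : ℝ → ℝ} (hf : Continuous f) (hg : Continuous g)
    (a : H →L[ℂ] H) (ξ : H) :
    cfc (fun x => f x * g x) a ξ = cfc f a (cfc g a ξ) := by
  rw [cfc_mul f g a hf.continuousOn hg.continuousOn]
  rfl

theorem cfc_apply_comm (f g : ℝ → ℝ) (a : H →L[ℂ] H) (ξ : H) :
    cfc f a (cfc g a ξ) = cfc g a (cfc f a ξ) :=
  DFunLike.congr_fun (cfc_commute_cfc f g a).eq ξ

theorem norm_sq_cfc_apply {f : ℝ → ℝ} (hf : Continuous f) (a : H →L[ℂ] H) (ξ : H) :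
    RCLike.re ⟪cfc (fun x => f x ^ 2) a ξ, ξ⟫_ℂ = ‖cfc f a ξ‖ ^ 2 := by
  have h : (fun x => f x ^ 2) = fun x => f x * f x := by ext x; ring
  rw [h, cfc_mul_apply hf hf, (cfc_predicate f a : IsSelfAdjoint _).inner_apply_left,
    inner_self_eq_norm_sq]

theorem norm_sq_cfc_apply_le_sum {ι : Type*} (a : H →L[ℂ] H) (s : Finset ι) {f : ℝ → ℝ} {φ : ι → ℝ → ℝ} (hf : Continuous f) (hφ : ∀ i, Continuous (φ i))
    {C : ℝ} (h : ∀ x ∈ spectrum ℝ a, f x ^ 2 ≤ C * ∑ i ∈ s, φ i x ^ 2) (ξ : H) :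
    ‖cfc f a ξ‖ ^ 2 ≤ C * ∑ i ∈ s, ‖cfc (φ i) a ξ‖ ^ 2 := by
  have hle : cfc (fun x => f x ^ 2) a ≤ cfc (fun x => C * ∑ i ∈ s, φ i x ^ 2) a :=
    cfc_mono h (by fun_prop) (by fun_prop)
  have hsum : cfc (fun x => C * ∑ i ∈ s, φ i x ^ 2) a
      = C • ∑ i ∈ s, cfc (fun x => φ i x ^ 2) a := by
    rw [cfc_const_mul C _ a (by fun_prop),
      ← cfc_sum (fun i x => φ i x ^ 2) a s (fun i _ => by fun_prop)]
    congr 2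
    ext x
    simp
  rw [hsum, ContinuousLinearMap.le_def] at hle
  have := hle.re_inner_nonneg_left ξ
  simp only [← norm_sq_cfc_apply hf, ← norm_sq_cfc_apply (hφ _)]
  rw [sub_apply, smul_apply, inner_sub_left, map_sub,
    RCLike.real_smul_eq_coe_smul (K := ℂ), inner_smul_left] at this
  simpa [sum_inner] using this

theorem norm_cfc_apply_le (a : H →L[ℂ] H) {f g : ℝ → ℝ}
    (hf : Continuous f) (hg : Continuous g) {C : ℝ} (hC : 0 ≤ C)
    (h : ∀ x ∈ spectrum ℝ a, |f x| ≤ C * |g x|) (ξ : H) : ‖cfc f a ξ‖ ≤ C * ‖cfc g a ξ‖ := by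
  have := norm_sq_cfc_apply_le_sum a (Finset.univ : Finset Unit) (φ := fun _ => g) hf
    (fun _ => hg) (C := C ^ 2) (fun x hx => by
      have := pow_le_pow_left₀ (abs_nonneg _) (h x hx) 2
      simpa [mul_pow] using this) ξ
  refine le_of_sq_le_sq ?_ (by positivity)
  simpa [mul_pow] using this

/-- If tent functions of `a` of width `ℓ` send `ζ` to vectors of norm `O(ℓ ^ 2)`, then `ζ` has no
component in the part of the spectrum covered by their centres. -/
theorem cfc_max_min_apply_eq_zero (a : H →L[ℂ] H) {p q r C : ℝ}
    (hpq : p < q) (hr : 0 < r) {ζ : H}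
    (h : ∀ t ∈ Set.Icc p q, ∀ ℓ, 0 < ℓ → ℓ ≤ r →
      ‖cfc (fun x => max 0 (ℓ - |min x q - t|)) a ζ‖ ≤ C * ℓ ^ 2) :
    cfc (fun x => max 0 (min x q - p)) a ζ = 0 := by
  set D := q - p with hD
  have hD0 : 0 < D := sub_pos.2 hpq
  have bound : ∀ n : ℕ, 2 * D / r ≤ n →
      ‖cfc (fun x => max 0 (min x q - p)) a ζ‖ ^ 2 ≤ (32 * C ^ 2 * D ^ 4) / (n + 1 : ℝ) := by
    intro n hn
    set ℓ := D / (n + 1 : ℝ) with hℓ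
    have hn1 : (0 : ℝ) < n + 1 := by positivity
    have hℓ0 : 0 < ℓ := by positivity
    have hDℓ : D = (n + 1) * ℓ := by rw [hℓ]; field_simp
    have hℓr : 2 * ℓ ≤ r := by
      rw [div_le_iff₀ hr] at hn
      rw [hℓ, ← mul_div_assoc, div_le_iff₀ hn1]
      nlinarith
    have key := norm_sq_cfc_apply_le_sum a (Finset.range (n + 2))
      (f := fun x => max 0 (min x q - p))
      (φ := fun i x => max 0 (2 * ℓ - |min x q - (p + i * ℓ)|)) (by fun_prop)
      (fun i => by fun_prop) (C := (n + 1 : ℝ) ^ 2) (fun x _ => by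
        rcases le_total (min x q - p) 0 with hx | hx
        · rw [max_eq_left hx]
          have : 0 ≤ ∑ i ∈ Finset.range (n + 2),
            (max 0 (2 * ℓ - |min x q - (p + i * ℓ)|)) ^ 2 := Finset.sum_nonneg fun _ _ => sq_nonneg _
          rw [zero_pow two_ne_zero]
          positivity
        · rw [max_eq_right hx]
          set y := min x q - p with hy
          have hyD : y ≤ D := sub_le_sub_right (min_le_right _ _) _
          set i := ⌊y / ℓ⌋₊ with hi
          have hi1 : (i : ℝ) * ℓ ≤ y := by
            rw [← le_div_iff₀ hℓ0]; exact Nat.floor_le (by positivity)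
          have hi2 : y < (i + 1) * ℓ := by
            rw [← div_lt_iff₀ hℓ0]; exact Nat.lt_floor_add_one _
          have hin : i ∈ Finset.range (n + 2) := by
            rw [Finset.mem_range]
            have : (i : ℝ) ≤ n + 1 := by
              refine le_of_mul_le_mul_right ?_ hℓ0
              linarith
            have : i ≤ n + 1 := by exact_mod_cast this
            omega
          have hφ : ℓ ≤ max 0 (2 * ℓ - |min x q - (p + i * ℓ)|) := by
            refine le_max_of_le_right ?_
            have : |min x q - (p + i * ℓ)| ≤ ℓ := by
              rw [abs_le]; constructor <;> linarith
            linarith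
          have hs := Finset.single_le_sum
            (f := fun i : ℕ => (max 0 (2 * ℓ - |min x q - (p + i * ℓ)|)) ^ 2)
            (fun _ _ => sq_nonneg _) hin
          calc y ^ 2 ≤ ((n + 1) * ℓ) ^ 2 := by rw [← hDℓ]; exact pow_le_pow_left₀ hx hyD 2
            _ = (n + 1 : ℝ) ^ 2 * ℓ ^ 2 := by ring
            _ ≤ _ := by
              refine mul_le_mul_of_nonneg_left (le_trans ?_ hs) (by positivity)
              exact pow_le_pow_left₀ hℓ0.le hφ 2) ζ
    have hterm : ∀ i ∈ Finset.range (n + 2),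
        ‖cfc (fun x => max 0 (2 * ℓ - |min x q - (p + i * ℓ)|)) a ζ‖ ^ 2
          ≤ (C * (2 * ℓ) ^ 2) ^ 2 := by
      intro i hi
      have hi' : (i : ℝ) ≤ n + 1 := by
        have := Finset.mem_range.1 hi
        exact_mod_cast (by omega : i ≤ n + 1)
      refine pow_le_pow_left₀ (norm_nonneg _) (h _ ⟨?_, ?_⟩ _ (by positivity) hℓr) 2
      · have : 0 ≤ (i : ℝ) * ℓ := by positivity
        linarith
      · have := mul_le_mul_of_nonneg_right hi' hℓ0.le
        linarith
    have hsum := Finset.sum_le_sum hterm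
    rw [Finset.sum_const, Finset.card_range, nsmul_eq_mul] at hsum
    refine (key.trans (mul_le_mul_of_nonneg_left hsum (by positivity))).trans ?_
    rw [le_div_iff₀ hn1, hDℓ]
    push_cast
    have : 0 ≤ C ^ 2 * ℓ ^ 4 * (n + 1 : ℝ) ^ 3 * n := by positivity
    nlinarith
  have hlim : Filter.Tendsto (fun n : ℕ => (32 * C ^ 2 * D ^ 4) / (n + 1 : ℝ)) Filter.atTop
      (nhds 0) := by
    refine Filter.Tendsto.div_atTop tendsto_const_nhds ?_
    exact Filter.tendsto_atTop_add_const_right _ _ tendsto_natCast_atTop_atTop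
  have h0 : ‖cfc (fun x => max 0 (min x q - p)) a ζ‖ ^ 2 ≤ 0 := by
    refine ge_of_tendsto hlim ?_
    filter_upwards [tendsto_natCast_atTop_atTop.eventually_ge_atTop (2 * D / r)] with n hn
    exact bound n hn
  simpa using le_antisymm h0 (sq_nonneg _)

section

attribute [local instance] InnerProductSpace.complexToReal

theorem IsSelfAdjoint.real_inner_apply_left {a : H →L[ℂ] H} (ha : IsSelfAdjoint a) (ξ η : H) :
    ⟪a ξ, η⟫_ℝ = ⟪ξ, a η⟫_ℝ :=
  congrArg Complex.re (ha.inner_apply_left ξ η)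

theorem norm_sq_apply_le_of_nonneg {F : H →L[ℂ] H} (hF : IsSelfAdjoint F)
    (hF0 : ∀ ξ, 0 ≤ ⟪F ξ, ξ⟫_ℝ) {K : ℝ} (hK : 0 < K) {ξ : H}
    (h : ⟪F (F ξ), F ξ⟫_ℝ ≤ K * ‖F ξ‖ ^ 2) : ‖F ξ‖ ^ 2 ≤ K * ⟪F ξ, ξ⟫_ℝ := by
  have := hF0 (K • ξ - F ξ)
  rw [map_sub, ContinuousLinearMap.map_smul_of_tower, inner_sub_left, inner_sub_right,
    inner_sub_right, real_inner_smul_left, real_inner_smul_left, real_inner_smul_right,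
    real_inner_smul_right, hF.real_inner_apply_left (F ξ) ξ, real_inner_self_eq_norm_sq] at this
  nlinarith

/-- An approximate eigenvector `ξ` of `a` at `t` is also one of `b`, provided that `a` is bounded
by `T ≤ √2 t` in the direction of `(a ^ 2 + t ^ 2 - 2 t b) ξ`. -/
theorem norm_sub_apply_le_of_approx_eigenvector {a b : H →L[ℂ] H}
    (ha : IsSelfAdjoint a) (hb : IsSelfAdjoint b) (hb0 : ∀ ξ, 0 ≤ ⟪b ξ, ξ⟫_ℝ)
    {t ℓ T : ℝ} (ht : 0 < t) (hℓ : 0 < ℓ) (hℓt : ℓ ≤ t) (hT : T ^ 2 ≤ 2 * t ^ 2)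
    (hab : ∀ ξ : H, 2 * t * ⟪a ξ, ξ⟫_ℝ ≤ ‖b ξ‖ ^ 2 + t ^ 2 * ‖ξ‖ ^ 2)
    (hba : ∀ ξ : H, 2 * t * ⟪b ξ, ξ⟫_ℝ ≤ ‖a ξ‖ ^ 2 + t ^ 2 * ‖ξ‖ ^ 2)
    {ξ d e : H} (hd : d = a ξ - t • ξ) (he : e = a d - t • d)
    (hdℓ : ‖d‖ ≤ ℓ * ‖ξ‖) (heℓ : ‖e‖ ≤ ℓ ^ 2 * ‖ξ‖)
    (hw : ‖a (e + (2 * t) • (a ξ - b ξ))‖ ≤ T * ‖e + (2 * t) • (a ξ - b ξ)‖) :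
    ‖a ξ - b ξ‖ ≤ 28 * ℓ * ‖ξ‖ := by
  set F : H →L[ℂ] H := a * a + t ^ 2 • (1 : H →L[ℂ] H) - (2 * t) • b with hF
  have hFapp : ∀ v, F v = a (a v) + t ^ 2 • v - (2 * t) • b v := fun v => rfl
  have haa : IsSelfAdjoint (a * a) := by simpa only [pow_two] using ha.pow 2
  have hFsa : IsSelfAdjoint F :=
    (haa.add ((IsSelfAdjoint.all (t ^ 2)).smul (IsSelfAdjoint.one _))).sub
      ((IsSelfAdjoint.all (2 * t)).smul hb)
  have hFq : ∀ v, ⟪F v, v⟫_ℝ = ‖a v‖ ^ 2 + t ^ 2 * ‖v‖ ^ 2 - 2 * t * ⟪b v, v⟫_ℝ := fun v => by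
    rw [hFapp, inner_sub_left, inner_add_left, real_inner_smul_left, real_inner_smul_left,
      ha.real_inner_apply_left, real_inner_self_eq_norm_sq, real_inner_self_eq_norm_sq]
  have hFξ : F ξ = e + (2 * t) • (a ξ - b ξ) := by
    rw [hFapp, he, hd, map_sub, ContinuousLinearMap.map_smul_of_tower]
    module
  rw [← hFξ] at hw
  have hcs : ‖F ξ‖ ^ 2 ≤ 3 * t ^ 2 * ⟪F ξ, ξ⟫_ℝ := by
    refine norm_sq_apply_le_of_nonneg hFsa (fun v => ?_) (by positivity) ?_
    · rw [hFq]; linarith [hba v]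
    · rw [hFq]
      have h₁ := pow_le_pow_left₀ (norm_nonneg _) hw 2
      rw [mul_pow] at h₁
      have h₂ := mul_le_mul_of_nonneg_right hT (sq_nonneg ‖F ξ‖)
      have h₃ := mul_nonneg (by positivity : 0 ≤ 2 * t) (hb0 (F ξ))
      linarith
  set y := a ξ - b ξ with hy
  have hbt : ‖b ξ - t • ξ‖ ≤ ‖y‖ + ℓ * ‖ξ‖ := by
    have : b ξ - t • ξ = d - y := by rw [hd, hy]; abel
    rw [this]
    linarith [norm_sub_le d y]
  have hq : ⟪F ξ, ξ⟫_ℝ ≤ ‖d‖ ^ 2 + ‖b ξ - t • ξ‖ ^ 2 := by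
    rw [hFq, hd, norm_sub_sq_real, norm_sub_sq_real, real_inner_smul_right, real_inner_smul_right,
      norm_smul, Real.norm_eq_abs, mul_pow, sq_abs]
    linarith [hab ξ]
  have hd2 := pow_le_pow_left₀ (norm_nonneg _) hdℓ 2
  have hbt2 := pow_le_pow_left₀ (norm_nonneg _) hbt 2
  have hξ := mul_nonneg hℓ.le (norm_nonneg ξ)
  have hFle : ‖F ξ‖ ≤ t * (9 / 5 * (‖y‖ + 2 * (ℓ * ‖ξ‖))) := by
    refine le_of_sq_le_sq ?_ (by positivity)
    have : ‖F ξ‖ ^ 2 ≤ t ^ 2 * (3 * ((ℓ * ‖ξ‖) ^ 2 + (‖y‖ + ℓ * ‖ξ‖) ^ 2)) := by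
      have := mul_le_mul_of_nonneg_left (hq.trans (add_le_add hd2 hbt2))
        (by positivity : 0 ≤ 3 * t ^ 2)
      linarith
    rw [mul_pow]
    refine this.trans (mul_le_mul_of_nonneg_left ?_ (sq_nonneg t))
    nlinarith [norm_nonneg y, mul_nonneg (norm_nonneg y) hξ]
  have hyle : 2 * t * ‖y‖ ≤ ‖F ξ‖ + ‖e‖ := by
    have : (2 * t) • y = F ξ - e := by rw [hFξ]; abel
    calc 2 * t * ‖y‖ = ‖(2 * t) • y‖ := by
          rw [norm_smul, Real.norm_eq_abs, abs_of_pos (by positivity)]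
      _ ≤ _ := by rw [this]; exact norm_sub_le _ _
  have heℓ' : ‖e‖ ≤ t * (ℓ * ‖ξ‖) := by
    refine heℓ.trans ?_
    nlinarith [mul_le_mul_of_nonneg_right hℓt hξ]
  refine le_of_mul_le_mul_left ?_ ht
  nlinarith [mul_nonneg ht.le hξ]

theorem apply_eq_cfc_min_apply {a : H →L[ℂ] H} (ha : IsSelfAdjoint a) {T : ℝ} {v : H}
    (hv : cfc (fun x => max 0 (x - T)) a v = 0) : a v = cfc (fun x => min x T) a v := by
  have h : cfc (fun x => min x T + max 0 (x - T)) a = a := by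
    conv_rhs => rw [← cfc_id ℝ a ha]
    congr 1
    ext x
    rcases le_total x T with hx | hx <;> simp [hx]
  rw [cfc_add (a := a) (fun x => min x T) (fun x => max 0 (x - T))] at h
  conv_lhs => rw [← h]
  rw [add_apply, hv, add_zero]

theorem norm_apply_le_of_cfc_max_sub_apply_eq_zero {a : H →L[ℂ] H} (ha : 0 ≤ a) {T : ℝ}
    (hT : 0 ≤ T) {v : H} (hv : cfc (fun x => max 0 (x - T)) a v = 0) : ‖a v‖ ≤ T * ‖v‖ := by
  rw [apply_eq_cfc_min_apply ha.isSelfAdjoint hv]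
  have := norm_cfc_apply_le a (f := fun x => min x T) (g := fun _ => 1) (by fun_prop)
    (by fun_prop) hT (fun x hx => by
      have hx0 : 0 ≤ x := spectrum_nonneg_of_nonneg ha hx
      rw [abs_of_nonneg (le_min hx0 hT)]
      simp) v
  rwa [cfc_const_one ℝ a ha.isSelfAdjoint] at this

theorem apply_sub_smul_eq_cfc_apply {a : H →L[ℂ] H} (ha : IsSelfAdjoint a) {T : ℝ} (t : ℝ) {v : H}
    (hv : cfc (fun x => max 0 (x - T)) a v = 0) :
    a v - t • v = cfc (fun x => min x T - t) a v := by
  rw [cfc_sub (fun x => min x T) (fun _ => t) a, cfc_const t a ha, apply_eq_cfc_min_apply ha hv,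
    sub_apply, Algebra.algebraMap_eq_smul_one]
  rfl

/-- If `a - b` vanishes on the part of the spectrum of `a` above `T`, then it also vanishes on the
part above `3 / 4 * T`. -/
theorem cfc_max_sub_apply_sub_eq_zero_step {a b : H →L[ℂ] H}
    (ha : 0 ≤ a) (hb : 0 ≤ b)
    (hab : ∀ t, 0 < t → ∀ ξ : H, 2 * t * ⟪a ξ, ξ⟫_ℝ ≤ ‖b ξ‖ ^ 2 + t ^ 2 * ‖ξ‖ ^ 2)
    (hba : ∀ t, 0 < t → ∀ ξ : H, 2 * t * ⟪b ξ, ξ⟫_ℝ ≤ ‖a ξ‖ ^ 2 + t ^ 2 * ‖ξ‖ ^ 2)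
    {T : ℝ} (hT : 0 < T) (h : ∀ η, cfc (fun x => max 0 (x - T)) a (a η - b η) = 0) (η : H) :
    cfc (fun x => max 0 (x - 3 / 4 * T)) a (a η - b η) = 0 := by
  have hasa := ha.isSelfAdjoint
  have hbsa := hb.isSelfAdjoint
  set ψ : ℝ → ℝ := fun x => max 0 (x - T) with hψ
  set ζ := a η - b η with hζ
  have hmain : cfc (fun x => max 0 (min x T - 3 / 4 * T)) a ζ = 0 := by
    refine cfc_max_min_apply_eq_zero a (r := 3 / 4 * T) (C := 28 * ‖η‖) (by linarith)
      (by linarith) fun t ht ℓ hℓ hℓr => ?_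
    set φ : ℝ → ℝ := fun x => max 0 (ℓ - |min x T - t|) with hφ
    have ht0 : 0 < t := by linarith [ht.1]
    have hφc : Continuous φ := by fun_prop
    have hφ0 : ∀ x, 0 ≤ φ x := fun x => le_max_left _ _
    have hφℓ : ∀ x, φ x ≤ ℓ := fun x => max_le hℓ.le (by linarith [abs_nonneg (min x T - t)])
    have hφm : ∀ x, |min x T - t| * φ x ≤ ℓ * φ x := fun x => by
      rcases le_total (ℓ - |min x T - t|) 0 with hx | hx
      · simp [hφ, max_eq_left hx]
      · exact mul_le_mul_of_nonneg_right (by linarith) (hφ0 x)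
    set ξ := cfc (fun x => φ x ^ 2) a ζ with hξ
    have hψξ : cfc ψ a ξ = 0 := by rw [hξ, cfc_apply_comm, h, map_zero]
    set d := cfc (fun x => min x T - t) a ξ with hd
    have hψd : cfc ψ a d = 0 := by rw [hd, cfc_apply_comm, hψξ, map_zero]
    set e := cfc (fun x => min x T - t) a d with he
    have hψe : cfc ψ a e = 0 := by rw [he, cfc_apply_comm, hψd, map_zero]
    have hm2 : ∀ x, |(min x T - t) * φ x ^ 2| ≤ ℓ * |φ x ^ 2| := fun x => by
      rw [abs_mul, abs_of_nonneg (sq_nonneg (φ x))]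
      nlinarith [mul_le_mul_of_nonneg_right (hφm x) (hφ0 x)]
    have hdℓ : ‖d‖ ≤ ℓ * ‖ξ‖ := by
      rw [hd, hξ, ← cfc_mul_apply (by fun_prop) (by fun_prop)]
      exact norm_cfc_apply_le a (by fun_prop) (by fun_prop) hℓ.le (fun x _ => hm2 x) ζ
    have heℓ : ‖e‖ ≤ ℓ ^ 2 * ‖ξ‖ := by
      have : ‖e‖ ≤ ℓ * ‖d‖ := by
        have hd' : d = cfc (fun x => (min x T - t) * φ x ^ 2) a ζ :=
          (cfc_mul_apply (by fun_prop) (by fun_prop) a ζ).symm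
        rw [he, hd', ← cfc_mul_apply (by fun_prop) (by fun_prop)]
        refine norm_cfc_apply_le a (by fun_prop) (by fun_prop) hℓ.le (fun x _ => ?_) ζ
        rw [abs_mul, abs_mul (min x T - t), abs_of_nonneg (sq_nonneg (φ x))]
        nlinarith [mul_le_mul_of_nonneg_right (hφm x)
          (mul_nonneg (abs_nonneg (min x T - t)) (hφ0 x))]
      nlinarith
    have hξℓ : ‖ξ‖ ≤ ℓ * ‖cfc φ a ζ‖ := by
      rw [hξ]
      refine norm_cfc_apply_le a (by fun_prop) hφc hℓ.le (fun x _ => ?_) ζ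
      rw [abs_of_nonneg (sq_nonneg _), abs_of_nonneg (hφ0 x)]
      nlinarith [hφ0 x, hφℓ x]
    have happrox : ‖a ξ - b ξ‖ ≤ 28 * ℓ * ‖ξ‖ := by
      refine norm_sub_apply_le_of_approx_eigenvector hasa hbsa
        (fun v => ((ContinuousLinearMap.nonneg_iff_isPositive b).1 hb).re_inner_nonneg_left v)
        ht0 hℓ (hℓr.trans ht.1) (T := T) (by nlinarith [ht.1]) (hab t ht0) (hba t ht0)
        (apply_sub_smul_eq_cfc_apply hasa t hψξ).symm
        (apply_sub_smul_eq_cfc_apply hasa t hψd).symm hdℓ heℓ ?_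
      refine norm_apply_le_of_cfc_max_sub_apply_eq_zero ha hT.le ?_
      rw [map_add, ContinuousLinearMap.map_smul_of_tower, hψe, h, smul_zero, add_zero]
    have hnorm : ‖cfc φ a ζ‖ ^ 2 ≤ 28 * ‖η‖ * ℓ ^ 2 * ‖cfc φ a ζ‖ := by
      have heq : ‖cfc φ a ζ‖ ^ 2 = ⟪a ξ - b ξ, η⟫_ℝ := by
        rw [← norm_sq_cfc_apply hφc, ← hξ, inner_sub_left, hasa.real_inner_apply_left,
          hbsa.real_inner_apply_left, ← inner_sub_right]
        rfl
      have h₁ := real_inner_le_norm (a ξ - b ξ) η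
      have h₂ := mul_le_mul_of_nonneg_right happrox (norm_nonneg η)
      have h₃ := mul_le_mul_of_nonneg_left hξℓ (by positivity : 0 ≤ 28 * ℓ * ‖η‖)
      rw [heq]
      linarith
    rcases (norm_nonneg (cfc φ a ζ)).eq_or_lt with h0 | h0
    · rw [← h0]; positivity
    · refine le_of_mul_le_mul_right ?_ h0
      linarith
  have hsplit : (fun x : ℝ => max 0 (x - 3 / 4 * T))
      = fun x => max 0 (min x T - 3 / 4 * T) + ψ x := by
    ext x
    rcases le_total x T with hx | hx
    · simp [hψ, hx]
    · simp only [hψ, min_eq_right hx]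
      rw [max_eq_right (by linarith), max_eq_right (by linarith), max_eq_right (by linarith)]
      ring
  rw [hsplit, cfc_add (a := a) (fun x => max 0 (min x T - 3 / 4 * T)) ψ, add_apply, hmain, h,
    add_zero]

/-- The inequalities `2 t a ≤ b ^ 2 + t ^ 2` and `2 t b ≤ a ^ 2 + t ^ 2` for all `t > 0` force
`a = b` when `a` is invertible: `a - b` is shown to vanish on ever larger parts of the spectrum of
`a`, starting from the top. -/
theorem eq_of_two_mul_inner_le {a b : H →L[ℂ] H} (ha : 0 ≤ a) (hb : 0 ≤ b) {c : ℝ} (hc : 0 < c)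
    (hac : ∀ ξ, c * ‖ξ‖ ≤ ‖a ξ‖)
    (hab : ∀ t, 0 < t → ∀ ξ : H, 2 * t * ⟪a ξ, ξ⟫_ℝ ≤ ‖b ξ‖ ^ 2 + t ^ 2 * ‖ξ‖ ^ 2)
    (hba : ∀ t, 0 < t → ∀ ξ : H, 2 * t * ⟪b ξ, ξ⟫_ℝ ≤ ‖a ξ‖ ^ 2 + t ^ 2 * ‖ξ‖ ^ 2) :
    a = b := by
  have hstep : ∀ (n : ℕ) (η : H),
      cfc (fun x => max 0 (x - (3 / 4) ^ n * (‖a‖ + 1))) a (a η - b η) = 0 := by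
    intro n
    induction n with
    | zero =>
      intro η
      have h0 : cfc (fun x => max 0 (x - (3 / 4) ^ 0 * (‖a‖ + 1))) a = 0 := by
        rw [← cfc_const_zero ℝ a]
        refine cfc_congr fun x hx => max_eq_left ?_
        have : ‖x‖ ≤ ‖a‖ * ‖(1 : H →L[ℂ] H)‖ := spectrum.norm_le_norm_mul_of_mem hx
        have h1 : ‖(1 : H →L[ℂ] H)‖ ≤ 1 := ContinuousLinearMap.norm_id_le
        have := le_abs_self x
        rw [Real.norm_eq_abs] at *
        nlinarith [norm_nonneg a]
      rw [h0]
      rfl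
    | succ n ih =>
      rw [pow_succ', mul_assoc]
      exact cfc_max_sub_apply_sub_eq_zero_step ha hb hab hba (by positivity) ih
  have hM : 0 < ‖a‖ + 1 := by positivity
  obtain ⟨n, hn⟩ := exists_pow_lt_of_lt_one (div_pos hc hM) (by norm_num : (3 / 4 : ℝ) < 1)
  rw [lt_div_iff₀ hM] at hn
  ext η
  have hle := (hac _).trans
    (norm_apply_le_of_cfc_max_sub_apply_eq_zero ha (by positivity) (hstep n η))
  rw [← sub_eq_zero, ← norm_eq_zero]
  nlinarith [norm_nonneg (a η - b η)]

end

theorem norm_sq_sqrt_apply {A : H →L[ℂ] H} (hA : 0 ≤ A) (ξ : H) :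
    ‖CFC.sqrt A ξ‖ ^ 2 = RCLike.re ⟪A ξ, ξ⟫_ℂ := by
  conv_rhs => rw [← CFC.sqrt_mul_sqrt_self A hA]
  rw [mul_apply_eq_comp, (CFC.sqrt_nonneg A).isSelfAdjoint.inner_apply_left,
    inner_self_eq_norm_sq]

theorem two_mul_inner_le_of_forall_unit {a B : H →L[ℂ] H} (hB : 0 ≤ B)
    (h : ∀ ξ : H, ‖ξ‖ = 1 → RCLike.re ⟪a ξ, ξ⟫_ℂ ≤ Real.sqrt (RCLike.re ⟪B ξ, ξ⟫_ℂ))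
    (t : ℝ) (ht : 0 < t) (ξ : H) :
    2 * t * RCLike.re ⟪a ξ, ξ⟫_ℂ ≤ ‖CFC.sqrt B ξ‖ ^ 2 + t ^ 2 * ‖ξ‖ ^ 2 := by
  rcases eq_or_ne ξ 0 with rfl | hξ
  · simp
  have hξ0 : 0 < ‖ξ‖ := norm_pos_iff.2 hξ
  have hu := h (((‖ξ‖⁻¹ : ℝ) : ℂ) • ξ) (by
    rw [norm_smul, Complex.norm_real, norm_inv, norm_norm, inv_mul_cancel₀ hξ0.ne'])
  rw [← norm_sq_sqrt_apply hB, Real.sqrt_sq (norm_nonneg _), map_smul, map_smul, inner_smul_left,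
    inner_smul_right, norm_smul, Complex.norm_real, norm_inv, norm_norm, Complex.conj_ofReal,
    RCLike.re_eq_complex_re, Complex.re_ofReal_mul, Complex.re_ofReal_mul] at hu
  have key : RCLike.re ⟪a ξ, ξ⟫_ℂ ≤ ‖CFC.sqrt B ξ‖ * ‖ξ‖ := by
    have := mul_le_mul_of_nonneg_left hu (sq_nonneg ‖ξ‖)
    field_simp at this
    simpa [mul_comm] using this
  have := mul_le_mul_of_nonneg_left key (by positivity : 0 ≤ 2 * t)
  nlinarith [sq_nonneg (‖CFC.sqrt B ξ‖ - t * ‖ξ‖)]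

theorem stmt10 (A B : H →L[ℂ] H) (hA : 0 ≤ A) (hB : 0 ≤ B)
    (hAinv : ∃ c : ℝ, 0 < c ∧ c • (1 : H →L[ℂ] H) ≤ A)
    (h1 : ∀ ξ : H, ‖ξ‖ = 1 →
      RCLike.re ⟪(CFC.sqrt A) ξ, ξ⟫_ℂ ≤ Real.sqrt (RCLike.re ⟪B ξ, ξ⟫_ℂ))
    (h2 : ∀ ξ : H, ‖ξ‖ = 1 →
      RCLike.re ⟪(CFC.sqrt B) ξ, ξ⟫_ℂ ≤ Real.sqrt (RCLike.re ⟪A ξ, ξ⟫_ℂ)) :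
    A = B := by
  obtain ⟨c, hc, hcA⟩ := hAinv
  have hac : ∀ ξ, Real.sqrt c * ‖ξ‖ ≤ ‖CFC.sqrt A ξ‖ := fun ξ => by
    refine le_of_sq_le_sq ?_ (norm_nonneg _)
    rw [norm_sq_sqrt_apply hA, mul_pow, Real.sq_sqrt hc.le]
    have := ((ContinuousLinearMap.le_def _ _).1 hcA).re_inner_nonneg_left ξ
    rw [sub_apply, smul_apply, inner_sub_left, map_sub, RCLike.real_smul_eq_coe_smul (K := ℂ),
      inner_smul_left, RCLike.conj_ofReal, RCLike.re_ofReal_mul, one_apply_eq_self,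
      inner_self_eq_norm_sq] at this
    linarith
  have hsqrt : CFC.sqrt A = CFC.sqrt B :=
    eq_of_two_mul_inner_le (CFC.sqrt_nonneg A) (CFC.sqrt_nonneg B) (Real.sqrt_pos.2 hc) hac
      (two_mul_inner_le_of_forall_unit hB h1) (two_mul_inner_le_of_forall_unit hA h2)
  rw [← CFC.sqrt_mul_sqrt_self A hA, hsqrt, CFC.sqrt_mul_sqrt_self B hB]
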